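/- Let X,Y be jointly distributed finite random variables and T(Y) a sufficient statistic for X (i.e., X–T(Y)–Y is a Markov chain). Then the Ahlswede–Körner/Wyner rate region R = {(R₁,R₂): R₁ ≥ H(X|U), R₂ ≥ I(Y;U) for some U with X–Y–U} equals R' = {(R₁,R₂): R₁ ≥ H(X|U), R₂ ≥ I(T(Y);U) for some U with X–T(Y)–U}. -/

import Mathlib

open scoped Classical BigOperators

/-- Probability of a set of outcomes under a pmf `p` on a finite sample space. -/
noncomputable def pr {Ω : Type*} [Fintype Ω] (p : Ω → ℝ) (s : Set Ω) : ℝ :=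
  ∑ ω, if ω ∈ s then p ω else 0

/-- `p` is a probability mass function on the finite sample space `Ω`. -/
def IsPMF {Ω : Type*} [Fintype Ω] (p : Ω → ℝ) : Prop :=
  (∀ ω, 0 ≤ p ω) ∧ (∑ ω, p ω) = 1

/-- The Markov chain `A – B – C`: `A` and `C` are conditionally independent given `B`. -/
def MarkovChain {Ω α β γ : Type*} [Fintype Ω] (p : Ω → ℝ)
    (A : Ω → α) (B : Ω → β) (C : Ω → γ) : Prop :=
  ∀ (a : α) (b : β) (c : γ),
    pr p {ω | A ω = a ∧ B ω = b ∧ C ω = c} * pr p {ω | B ω = b} =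
      pr p {ω | A ω = a ∧ B ω = b} * pr p {ω | B ω = b ∧ C ω = c}

/-- Conditional Shannon entropy `H(A | B)`. -/
noncomputable def condEnt {Ω α β : Type*} [Fintype Ω] [Fintype α] [Fintype β]
    (p : Ω → ℝ) (A : Ω → α) (B : Ω → β) : ℝ :=
  -∑ a : α, ∑ b : β,
    pr p {ω | A ω = a ∧ B ω = b} *
      Real.log (pr p {ω | A ω = a ∧ B ω = b} / pr p {ω | B ω = b})

/-- Mutual information `I(A ; B)`. -/
noncomputable def mutInfo {Ω α β : Type*} [Fintype Ω] [Fintype α] [Fintype β]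
    (p : Ω → ℝ) (A : Ω → α) (B : Ω → β) : ℝ :=
  ∑ a : α, ∑ b : β,
    pr p {ω | A ω = a ∧ B ω = b} *
      Real.log (pr p {ω | A ω = a ∧ B ω = b} /
        (pr p {ω | A ω = a} * pr p {ω | B ω = b}))

/-- Conditional mutual information `I(A ; B | C) = H(A|C) - H(A|B,C)`. -/
noncomputable def condMI {Ω α β γ : Type*} [Fintype Ω] [Fintype α] [Fintype β] [Fintype γ]
    (p : Ω → ℝ) (A : Ω → α) (B : Ω → β) (C : Ω → γ) : ℝ :=
  condEnt p A C - condEnt p A (fun ω => (B ω, C ω))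

/-- Attaching to each outcome `(x, y)` of `p` a third coordinate drawn from the kernel `K y`. -/
noncomputable def attachKernel {α β γ : Type*} (p : α × β → ℝ) (K : β → γ → ℝ) :
    α × β × γ → ℝ :=
  fun ω => p (ω.1, ω.2.1) * K ω.2.1 ω.2.2

section Probability

variable {Ω α β γ δ : Type*} [Fintype Ω] {p : Ω → ℝ}

theorem pr_nonneg (hp : ∀ ω, 0 ≤ p ω) (s : Set Ω) : 0 ≤ pr p s :=
  Finset.sum_nonneg fun ω _ => by split_ifs <;> simp [hp ω]

theorem pr_mono (hp : ∀ ω, 0 ≤ p ω) {s t : Set Ω} (h : s ⊆ t) : pr p s ≤ pr p t := by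
  refine Finset.sum_le_sum fun ω _ => ?_
  by_cases hs : ω ∈ s
  · simp [hs, h hs]
  · by_cases ht : ω ∈ t <;> simp [hs, ht, hp ω]

theorem pr_eq_zero_of_subset (hp : ∀ ω, 0 ≤ p ω) {s t : Set Ω} (h : s ⊆ t)
    (ht : pr p t = 0) : pr p s = 0 :=
  le_antisymm (ht ▸ pr_mono hp h) (pr_nonneg hp s)

theorem sum_pr_mul [Fintype β] (B : Ω → β) (S : Ω → Prop) (g : β → ℝ) :
    ∑ b, pr p {ω | B ω = b ∧ S ω} * g b = ∑ ω, if S ω then p ω * g (B ω) else 0 := by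
  simp only [pr, Finset.sum_mul, Set.mem_ofPred_eq]
  rw [Finset.sum_comm]
  refine Finset.sum_congr rfl fun ω _ => ?_
  by_cases h : S ω <;> simp [h]

theorem sum_pr_fiber [Fintype β] (B : Ω → β) (S : Ω → Prop) :
    ∑ b, pr p {ω | B ω = b ∧ S ω} = pr p {ω | S ω} := by
  simpa [pr] using sum_pr_mul (p := p) B S fun _ => 1

theorem sum_pr_mul_comp [Fintype β] [Fintype δ] (B : Ω → β) (f : β → δ) (S : Ω → Prop)
    (g : δ → ℝ) :
    ∑ b, pr p {ω | B ω = b ∧ S ω} * g (f b) =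
      ∑ t, pr p {ω | f (B ω) = t ∧ S ω} * g t := by
  rw [sum_pr_mul B S fun b => g (f b), sum_pr_mul (fun ω => f (B ω)) S g]

theorem sum_ite_pr_eq_pr_comp [Fintype β] (B : Ω → β) (f : β → δ) (S : Ω → Prop) (t : δ) :
    ∑ b, (if f b = t then pr p {ω | B ω = b ∧ S ω} else 0) =
      pr p {ω | f (B ω) = t ∧ S ω} := by
  have h := sum_pr_mul (p := p) B S fun b => if f b = t then 1 else 0
  simp only [mul_ite, mul_one, mul_zero] at h
  rw [h, pr]
  refine Finset.sum_congr rfl fun ω _ => ?_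
  by_cases h₁ : S ω <;> by_cases h₂ : f (B ω) = t <;> simp [h₁, h₂]

theorem MarkovChain.comp_middle [Fintype β] (hp : ∀ ω, 0 ≤ p ω) {A : Ω → α} {B : Ω → β}
    {C : Ω → γ} {f : β → δ} (hf : MarkovChain p A (fun ω => f (B ω)) B)
    (h : MarkovChain p A B C) : MarkovChain p A (fun ω => f (B ω)) C := by
  intro a t c
  have key : ∀ b, f b = t → pr p {ω | B ω = b ∧ A ω = a ∧ C ω = c} * pr p {ω | f (B ω) = t} =
      pr p {ω | A ω = a ∧ f (B ω) = t} * pr p {ω | B ω = b ∧ C ω = c} := by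
    rintro b rfl
    have h₁ := h a b c
    have h₂ := hf a (f b) b
    have e₁ : {ω | A ω = a ∧ f (B ω) = f b ∧ B ω = b} = {ω | A ω = a ∧ B ω = b} := by
      ext ω; simp; grind
    have e₂ : {ω | f (B ω) = f b ∧ B ω = b} = {ω | B ω = b} := by
      ext ω; simp; grind
    have e₃ : {ω | B ω = b ∧ A ω = a ∧ C ω = c} = {ω | A ω = a ∧ B ω = b ∧ C ω = c} := by
      ext ω; simp; grind
    rw [e₁, e₂] at h₂
    rw [e₃]
    by_cases h0 : pr p {ω | B ω = b} = 0
    · rw [pr_eq_zero_of_subset hp (fun ω hω => hω.2.1) h0,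
        pr_eq_zero_of_subset hp (s := {ω | B ω = b ∧ C ω = c}) (fun ω hω => hω.1) h0]
      simp
    · refine mul_right_cancel₀ h0 ?_
      linear_combination pr p {ω | f (B ω) = f b} * h₁ + pr p {ω | B ω = b ∧ C ω = c} * h₂
  have e : {ω | A ω = a ∧ f (B ω) = t ∧ C ω = c} =
      {ω | f (B ω) = t ∧ A ω = a ∧ C ω = c} := by
    ext ω; simp; grind
  rw [e, ← sum_ite_pr_eq_pr_comp B f (fun ω => A ω = a ∧ C ω = c),
    ← sum_ite_pr_eq_pr_comp B f (fun ω => C ω = c), Finset.sum_mul, Finset.mul_sum]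
  refine Finset.sum_congr rfl fun b _ => ?_
  split_ifs with hb
  · exact key b hb
  · simp

end Probability

/-- The log sum inequality. -/
theorem log_sum_inequality {ι : Type*} (s : Finset ι) (a b : ι → ℝ) (ha : ∀ i, 0 ≤ a i)
    (hb : ∀ i, 0 ≤ b i) (hab : ∀ i, b i = 0 → a i = 0) :
    (∑ i ∈ s, a i) * Real.log ((∑ i ∈ s, a i) / ∑ i ∈ s, b i) ≤
      ∑ i ∈ s, a i * Real.log (a i / b i) := by
  set A := ∑ i ∈ s, a i with hA
  set B := ∑ i ∈ s, b i with hB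
  rcases (Finset.sum_nonneg fun i _ => ha i : 0 ≤ A).eq_or_lt with hA0 | hA0
  · have hz := (Finset.sum_eq_zero_iff_of_nonneg fun i _ => ha i).1 hA0.symm
    rw [Finset.sum_eq_zero (f := fun i => a i * Real.log (a i / b i))
        fun i hi => by simp [hz i hi],
      show A = 0 from hA0.symm, zero_mul]
  have hB0 : 0 < B := by
    refine (Finset.sum_nonneg fun i _ => hb i : 0 ≤ B).lt_of_ne fun h => hA0.ne' ?_
    have hz := (Finset.sum_eq_zero_iff_of_nonneg fun i _ => hb i).1 h.symm
    exact Finset.sum_eq_zero fun i hi => hab i (hz i hi)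
  have tangent : ∀ i, a i * Real.log (A / B) + (a i - b i * (A / B)) ≤
      a i * Real.log (a i / b i) := by
    intro i
    rcases (ha i).eq_or_lt with h | h
    · have := mul_nonneg (hb i) (div_pos hA0 hB0).le
      rw [← h]; linarith
    have hbi : 0 < b i := (hb i).lt_of_ne fun h' => h.ne' (hab i h'.symm)
    have hx : 0 < (a i / b i) / (A / B) := by positivity
    have hlog := mul_le_mul_of_nonneg_left (Real.one_sub_inv_le_log_of_pos hx) h.le
    rw [Real.log_div (by positivity) (by positivity)] at hlog
    have : a i * (1 - ((a i / b i) / (A / B))⁻¹) = a i - b i * (A / B) := by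
      field_simp
    linarith
  calc A * Real.log (A / B) = ∑ i ∈ s, (a i * Real.log (A / B) + (a i - b i * (A / B))) := by
        rw [Finset.sum_add_distrib, Finset.sum_sub_distrib, ← Finset.sum_mul, ← Finset.sum_mul,
          ← hA, ← hB]
        field_simp
        ring
    _ ≤ _ := Finset.sum_le_sum fun i _ => tangent i

/-- The data processing inequality for a deterministic function of the first variable. -/
theorem mutInfo_comp_le {Ω β γ δ : Type*} [Fintype Ω] [Fintype β] [Fintype γ] [Fintype δ]
    {p : Ω → ℝ} (hp : ∀ ω, 0 ≤ p ω) (B : Ω → β) (f : β → δ) (C : Ω → γ) :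
    mutInfo p (fun ω => f (B ω)) C ≤ mutInfo p B C := by
  unfold mutInfo
  rw [← Finset.sum_fiberwise Finset.univ f]
  refine Finset.sum_le_sum fun t _ => ?_
  rw [Finset.sum_comm]
  refine Finset.sum_le_sum fun c _ => ?_
  have h := log_sum_inequality (Finset.univ.filter fun b => f b = t)
    (fun b => pr p {ω | B ω = b ∧ C ω = c})
    (fun b => pr p {ω | B ω = b} * pr p {ω | C ω = c})
    (fun b => pr_nonneg hp _) (fun b => mul_nonneg (pr_nonneg hp _) (pr_nonneg hp _))
    (fun b hb => by
      rcases mul_eq_zero.1 hb with h | h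
      · exact pr_eq_zero_of_subset hp (fun ω hω => hω.1) h
      · exact pr_eq_zero_of_subset hp (fun ω hω => hω.2) h)
  have hT := sum_ite_pr_eq_pr_comp (p := p) B f (fun _ => True) t
  simp only [and_true] at hT
  rw [← Finset.sum_mul, Finset.sum_filter, Finset.sum_filter,
    sum_ite_pr_eq_pr_comp B f (fun ω => C ω = c), hT] at h
  exact h

section Marginal

variable {α β γ δ : Type*} [Fintype α] [Fintype β] [Fintype γ]

theorem pr_of_marginal {p : α × β → ℝ} {q : α × β × γ → ℝ}
    (hq : ∀ x y, ∑ u, q (x, y, u) = p (x, y)) (S : α → β → Prop) :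
    pr q {ω | S ω.1 ω.2.1} = pr p {z | S z.1 z.2} := by
  simp only [pr, Fintype.sum_prod_type, Set.mem_ofPred_eq]
  refine Finset.sum_congr rfl fun x _ => Finset.sum_congr rfl fun y _ => ?_
  split_ifs <;> simp [hq]

theorem MarkovChain.of_marginal {p : α × β → ℝ} {q : α × β × γ → ℝ}
    (hq : ∀ x y, ∑ u, q (x, y, u) = p (x, y)) {T : β → δ}
    (h : MarkovChain p (fun ω => ω.1) (fun ω => T ω.2) (fun ω => ω.2)) :
    MarkovChain q (fun ω => ω.1) (fun ω => T ω.2.1) (fun ω => ω.2.1) := by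
  intro a t b
  have := h a t b
  rwa [← pr_of_marginal hq fun x y => x = a ∧ T y = t ∧ y = b,
    ← pr_of_marginal hq fun _ y => T y = t, ← pr_of_marginal hq fun x y => x = a ∧ T y = t,
    ← pr_of_marginal hq fun _ y => T y = t ∧ y = b] at this

variable (p : α × β → ℝ) (K : β → γ → ℝ)

theorem pr_attachKernel (S : α → β → Prop) (u : γ) :
    pr (attachKernel p K) {ω | S ω.1 ω.2.1 ∧ ω.2.2 = u} =
      ∑ y, pr p {z | z.2 = y ∧ S z.1 z.2} * K y u := by
  rw [sum_pr_mul (fun z : α × β => z.2) (fun z => S z.1 z.2) fun y => K y u]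
  simp only [pr, attachKernel, Fintype.sum_prod_type, Set.mem_ofPred_eq]
  refine Finset.sum_congr rfl fun x _ => Finset.sum_congr rfl fun y _ => ?_
  by_cases h : S x y <;> simp [h]

theorem pr_attachKernel_snd (S : α → Prop) (y : β) (u : γ) :
    pr (attachKernel p K) {ω | S ω.1 ∧ ω.2.1 = y ∧ ω.2.2 = u} =
      pr p {z | S z.1 ∧ z.2 = y} * K y u := by
  have h := pr_attachKernel p K (fun x y' => S x ∧ y' = y) u
  simp only [and_assoc] at h
  rw [h, Finset.sum_eq_single y]
  · congr 2; ext z; simp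
  · intro b _ hb
    have : {z : α × β | z.2 = b ∧ S z.1 ∧ z.2 = y} = ∅ := by
      ext z; simp; grind
    simp [this, pr]
  · simp

theorem markovChain_attachKernel (hK : ∀ x y, ∑ u, attachKernel p K (x, y, u) = p (x, y)) :
    MarkovChain (attachKernel p K) (fun ω => ω.1) (fun ω => ω.2.1) (fun ω => ω.2.2) := by
  intro x y u
  have h := pr_attachKernel_snd p K (fun _ => True) y u
  simp only [true_and] at h
  rw [h, pr_attachKernel_snd p K (fun x' => x' = x) y u, pr_of_marginal hK fun _ y' => y' = y,
    pr_of_marginal hK fun x' y' => x' = x ∧ y' = y]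
  ring

end Marginal

section SufficientStatistic

variable {α β γ δ : Type*} [Fintype α] [Fintype β] [Fintype γ]

/-- The conditional probability `q(u | t)` that the third coordinate is `u` given that `T` of the
second coordinate is `t`. -/
noncomputable def statKernel (q : α × β × γ → ℝ) (T : β → δ) (t : δ) (u : γ) : ℝ :=
  pr q {ω | T ω.2.1 = t ∧ ω.2.2 = u} / pr q {ω | T ω.2.1 = t}

variable {p : α × β → ℝ} {q : α × β × γ → ℝ} {T : β → δ}

theorem statKernel_nonneg (hq : ∀ ω, 0 ≤ q ω) (t : δ) (u : γ) : 0 ≤ statKernel q T t u :=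
  div_nonneg (pr_nonneg hq _) (pr_nonneg hq _)

theorem pr_mul_statKernel (hq : ∀ ω, 0 ≤ q ω) (t : δ) (u : γ) :
    pr q {ω | T ω.2.1 = t} * statKernel q T t u = pr q {ω | T ω.2.1 = t ∧ ω.2.2 = u} := by
  by_cases h : pr q {ω | T ω.2.1 = t} = 0
  · rw [h, zero_mul, pr_eq_zero_of_subset hq (fun ω hω => hω.1) h]
  · exact mul_div_cancel₀ _ h

theorem sum_attachKernel_statKernel (hp : ∀ z, 0 ≤ p z)
    (hm : ∀ x y, ∑ u, q (x, y, u) = p (x, y)) (x : α) (y : β) :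
    ∑ u, attachKernel p (fun y => statKernel q T (T y)) (x, y, u) = p (x, y) := by
  simp only [attachKernel, ← Finset.mul_sum]
  by_cases h : pr q {ω | T ω.2.1 = T y} = 0
  · rw [pr_of_marginal hm fun _ y' => T y' = T y] at h
    have h0 := pr_eq_zero_of_subset hp (s := {(x, y)}) (by simp) h
    have : p (x, y) = 0 := by simpa [pr] using h0
    simp [this]
  · have hs : ∑ u, pr q {ω | T ω.2.1 = T y ∧ ω.2.2 = u} = pr q {ω | T ω.2.1 = T y} := by
      simp only [and_comm (a := T _ = T y)]
      exact sum_pr_fiber (fun ω : α × β × γ => ω.2.2) fun ω => T ω.2.1 = T y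
    simp only [statKernel, ← Finset.sum_div, hs, div_self h, mul_one]

variable [Fintype δ]

theorem pr_attachKernel_statKernel (hq : ∀ ω, 0 ≤ q ω)
    (hm : ∀ x y, ∑ u, q (x, y, u) = p (x, y))
    (hmk : MarkovChain q (fun ω => ω.1) (fun ω => T ω.2.1) (fun ω => ω.2.2)) (x : α) (u : γ) :
    pr (attachKernel p fun y => statKernel q T (T y)) {ω | ω.1 = x ∧ ω.2.2 = u} =
      pr q {ω | ω.1 = x ∧ ω.2.2 = u} := by
  rw [pr_attachKernel p _ fun x' _ => x' = x,
    sum_pr_mul_comp (fun z : α × β => z.2) T (fun z => z.1 = x) fun t => statKernel q T t u,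
    ← sum_pr_fiber (fun ω : α × β × γ => T ω.2.1) fun ω => ω.1 = x ∧ ω.2.2 = u]
  refine Finset.sum_congr rfl fun t _ => ?_
  have e : {ω : α × β × γ | T ω.2.1 = t ∧ ω.1 = x ∧ ω.2.2 = u} =
      {ω | ω.1 = x ∧ T ω.2.1 = t ∧ ω.2.2 = u} := by
    ext ω; simp; tauto
  rw [e, ← pr_of_marginal hm fun x' y => T y = t ∧ x' = x]
  simp only [and_comm (b := _ = x)]
  have h := hmk x t u
  by_cases h0 : pr q {ω | T ω.2.1 = t} = 0
  · rw [pr_eq_zero_of_subset hq (fun ω hω => hω.2) h0,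
      pr_eq_zero_of_subset hq (fun ω hω => hω.2.1) h0, zero_mul]
  · rw [statKernel, ← mul_div_assoc, ← h, mul_div_cancel_right₀ _ h0]

theorem pr_snd_attachKernel_statKernel (hq : ∀ ω, 0 ≤ q ω)
    (hm : ∀ x y, ∑ u, q (x, y, u) = p (x, y))
    (hmk : MarkovChain q (fun ω => ω.1) (fun ω => T ω.2.1) (fun ω => ω.2.2)) (u : γ) :
    pr (attachKernel p fun y => statKernel q T (T y)) {ω | ω.2.2 = u} =
      pr q {ω | ω.2.2 = u} := by
  rw [← sum_pr_fiber (fun ω : α × β × γ => ω.1), ← sum_pr_fiber (fun ω : α × β × γ => ω.1)]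
  exact Finset.sum_congr rfl fun x _ => pr_attachKernel_statKernel hq hm hmk x u

theorem condEnt_attachKernel_statKernel (hq : ∀ ω, 0 ≤ q ω)
    (hm : ∀ x y, ∑ u, q (x, y, u) = p (x, y))
    (hmk : MarkovChain q (fun ω => ω.1) (fun ω => T ω.2.1) (fun ω => ω.2.2)) :
    condEnt (attachKernel p fun y => statKernel q T (T y)) (fun ω => ω.1) (fun ω => ω.2.2) =
      condEnt q (fun ω => ω.1) (fun ω => ω.2.2) := by
  simp only [condEnt, pr_attachKernel_statKernel hq hm hmk,
    pr_snd_attachKernel_statKernel hq hm hmk]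

theorem mutInfo_attachKernel_statKernel (hp : ∀ z, 0 ≤ p z) (hq : ∀ ω, 0 ≤ q ω)
    (hm : ∀ x y, ∑ u, q (x, y, u) = p (x, y))
    (hmk : MarkovChain q (fun ω => ω.1) (fun ω => T ω.2.1) (fun ω => ω.2.2)) :
    mutInfo (attachKernel p fun y => statKernel q T (T y))
        (fun ω => ω.2.1) (fun ω => ω.2.2) =
      mutInfo q (fun ω => T ω.2.1) (fun ω => ω.2.2) := by
  unfold mutInfo
  rw [Finset.sum_comm, Finset.sum_comm (γ := δ)]
  refine Finset.sum_congr rfl fun u _ => ?_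
  have cancel : ∀ a k r : ℝ,
      a * k * Real.log (a * k / (a * r)) = a * (k * Real.log (k / r)) := by
    intro a k r
    by_cases ha : a = 0
    · simp [ha]
    · rw [mul_div_mul_left _ _ ha, mul_assoc]
  have hY : ∀ y, pr (attachKernel p fun y => statKernel q T (T y))
      {ω | ω.2.1 = y ∧ ω.2.2 = u} = pr p {z | z.2 = y} * statKernel q T (T y) u := fun y => by
    simpa using pr_attachKernel_snd p (fun y => statKernel q T (T y)) (fun _ => True) y u
  have h := sum_pr_mul_comp (p := p) (fun z => z.2) T (fun _ => True)
    fun t => statKernel q T t u * Real.log (statKernel q T t u / pr q {ω | ω.2.2 = u})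
  simp only [and_true] at h
  have hY' : ∀ y, pr (attachKernel p fun y => statKernel q T (T y)) {ω | ω.2.1 = y} =
      pr p {z | z.2 = y} := fun y =>
    pr_of_marginal (sum_attachKernel_statKernel (T := T) hp hm) fun _ y' => y' = y
  have hT : ∀ t, pr q {ω | T ω.2.1 = t} = pr p {z | T z.2 = t} := fun t =>
    pr_of_marginal hm fun _ y => T y = t
  simp only [hY, hY', pr_snd_attachKernel_statKernel hq hm hmk, ← pr_mul_statKernel hq, hT,
    cancel, h]

end SufficientStatistic

/-- Theorem 6: if `T(Y)` is sufficient for `X` (Markov chain `X – T(Y) – Y`), the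
Ahlswede–Körner/Wyner rate region for coded side information `Y` equals the one where the side
information is reduced to `T(Y)`. -/
theorem rate_region_sufficient_statistic
    {𝒳 𝒴 𝒯 : Type} [Fintype 𝒳] [Fintype 𝒴] [Fintype 𝒯]
    (p : 𝒳 × 𝒴 → ℝ) (hp : IsPMF p) (T : 𝒴 → 𝒯)
    (hsuff : MarkovChain p (fun ω => ω.1) (fun ω => T ω.2) (fun ω => ω.2)) :
    {r : ℝ × ℝ | ∃ (𝒰 : Type) (_ : Fintype 𝒰) (q : 𝒳 × 𝒴 × 𝒰 → ℝ),
        IsPMF q ∧ (∀ x y, (∑ u, q (x, y, u)) = p (x, y)) ∧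
        MarkovChain q (fun ω => ω.1) (fun ω => ω.2.1) (fun ω => ω.2.2) ∧
        condEnt q (fun ω => ω.1) (fun ω => ω.2.2) ≤ r.1 ∧
        mutInfo q (fun ω => ω.2.1) (fun ω => ω.2.2) ≤ r.2} =
      {r : ℝ × ℝ | ∃ (𝒰 : Type) (_ : Fintype 𝒰) (q : 𝒳 × 𝒴 × 𝒰 → ℝ),
        IsPMF q ∧ (∀ x y, (∑ u, q (x, y, u)) = p (x, y)) ∧
        MarkovChain q (fun ω => ω.1) (fun ω => T ω.2.1) (fun ω => ω.2.2) ∧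
        condEnt q (fun ω => ω.1) (fun ω => ω.2.2) ≤ r.1 ∧
        mutInfo q (fun ω => T ω.2.1) (fun ω => ω.2.2) ≤ r.2} := by
  ext r
  constructor
  · rintro ⟨𝒰, _, q, hq, hm, hmk, h₁, h₂⟩
    exact ⟨𝒰, _, q, hq, hm, (hsuff.of_marginal hm).comp_middle hq.1 hmk, h₁,
      (mutInfo_comp_le hq.1 _ T _).trans h₂⟩
  · rintro ⟨𝒰, _, q, hq, hm, hmk, h₁, h₂⟩
    have hm' := sum_attachKernel_statKernel (T := T) hp.1 hm
    refine ⟨𝒰, _, attachKernel p fun y => statKernel q T (T y), ⟨fun ω => ?_, ?_⟩, hm',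
      markovChain_attachKernel p _ hm', ?_, ?_⟩
    · exact mul_nonneg (hp.1 _) (statKernel_nonneg hq.1 _ _)
    · simpa only [Fintype.sum_prod_type, hm'] using hp.2
    · rwa [condEnt_attachKernel_statKernel hq.1 hm hmk]
    · rwa [mutInfo_attachKernel_statKernel hp.1 hq.1 hm hmk]
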